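/- For all d, p ∈ ℕ there exists an increasing function g : ℕ → ℕ such that, setting ζ_{d,p}(n₁,n₂) = tower(n₂, g(d)·(n₁+1)·(n₁ + ⌈log₂ p⌉)), for every m ∈ ℕ with m ≥ 1 and every tree t ∈ T_{d,p}, there exists a leaf-hereditary subtree t' of t such that: (i) t' and t have the same height, (ii) the cardinality of t' is at most ζ_{d,p}(m,d), and (iii) t' ≡^MSO_m t. -/

import Mathlib

open Cardinal

/-- The tower function: `tower 0 n = n`, `tower (d+1) n = 2 ^ tower d n`. -/
def tower : ℕ → ℕ → ℕ
  | 0, n => n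
  | d + 1, n => 2 ^ tower d n

/-- MSO formulas over the vocabulary consisting of one binary relation symbol `E`
and unary relation symbols indexed by `ι`.  First-order variables and set
variables are both indexed by `ℕ`. -/
inductive MSOForm (ι : Type u) : Type u
  | fal : MSOForm ι
  | eq : ℕ → ℕ → MSOForm ι
  | edge : ℕ → ℕ → MSOForm ι
  | pred : ι → ℕ → MSOForm ι
  | mem : ℕ → ℕ → MSOForm ι
  | imp : MSOForm ι → MSOForm ι → MSOForm ι
  | exFO : ℕ → MSOForm ι → MSOForm ι
  | exSO : ℕ → MSOForm ι → MSOForm ι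

namespace MSOForm

variable {ι : Type u}

/-- Quantifier rank: the maximum nesting depth of (first- and second-order) quantifiers. -/
def qr : MSOForm ι → ℕ
  | fal => 0
  | eq _ _ => 0
  | edge _ _ => 0
  | pred _ _ => 0
  | mem _ _ => 0
  | imp φ ψ => max φ.qr ψ.qr
  | exFO _ φ => φ.qr + 1
  | exSO _ φ => φ.qr + 1

/-- Free first-order variables. -/
def freeFO : MSOForm ι → Finset ℕ
  | fal => ∅
  | eq i j => {i, j}
  | edge i j => {i, j}
  | pred _ i => {i}
  | mem i _ => {i}
  | imp φ ψ => φ.freeFO ∪ ψ.freeFO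
  | exFO n φ => φ.freeFO.erase n
  | exSO _ φ => φ.freeFO

/-- Free set variables. -/
def freeSO : MSOForm ι → Finset ℕ
  | fal => ∅
  | eq _ _ => ∅
  | edge _ _ => ∅
  | pred _ _ => ∅
  | mem _ X => {X}
  | imp φ ψ => φ.freeSO ∪ ψ.freeSO
  | exFO _ φ => φ.freeSO
  | exSO X φ => φ.freeSO.erase X

/-- A sentence is a formula with no free variables of either kind. -/
def IsSentence (φ : MSOForm ι) : Prop := φ.freeFO = ∅ ∧ φ.freeSO = ∅

/-- First-order formulas: no set quantification and no set membership. -/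
def IsFO : MSOForm ι → Prop
  | fal => True
  | eq _ _ => True
  | edge _ _ => True
  | pred _ _ => True
  | mem _ _ => False
  | imp φ ψ => φ.IsFO ∧ ψ.IsFO
  | exFO _ φ => φ.IsFO
  | exSO _ _ => False

/-- Formulas that do not mention the binary relation symbol `E`
(i.e. formulas over a purely monadic vocabulary). -/
def NoEdge : MSOForm ι → Prop
  | fal => True
  | eq _ _ => True
  | edge _ _ => False
  | pred _ _ => True
  | mem _ _ => True
  | imp φ ψ => φ.NoEdge ∧ ψ.NoEdge
  | exFO _ φ => φ.NoEdge
  | exSO _ φ => φ.NoEdge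

end MSOForm

/-- A structure over the vocabulary with one binary relation `E` and `ι`-indexed
unary predicates: a universe, a binary relation and unary relations. -/
structure MStr (ι : Type u) where
  V : Type
  E : V → V → Prop
  P : ι → V → Prop

namespace MStr

/-- Satisfaction of an MSO formula under first-order and set variable assignments. -/
def Realize {ι : Type u} (M : MStr ι) : MSOForm ι → (ℕ → M.V) → (ℕ → Set M.V) → Prop
  | .fal, _, _ => False
  | .eq i j, v, _ => v i = v j
  | .edge i j, v, _ => M.E (v i) (v j)
  | .pred a i, v, _ => M.P a (v i)
  | .mem i X, v, s => v i ∈ s X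
  | .imp φ ψ, v, s => Realize M φ v s → Realize M ψ v s
  | .exFO n φ, v, s => ∃ x : M.V, Realize M φ (Function.update v n x) s
  | .exSO X φ, v, s => ∃ A : Set M.V, Realize M φ v (Function.update s X A)

/-- A structure satisfies a sentence. -/
def Sat {ι : Type u} (M : MStr ι) (φ : MSOForm ι) : Prop :=
  ∀ (v : ℕ → M.V) (s : ℕ → Set M.V), M.Realize φ v s

/-- `M ≡^MSO_m N` : `M` and `N` agree on all MSO sentences of quantifier rank at most `m`. -/
def MSOEquiv {ι : Type u} (m : ℕ) (M N : MStr ι) : Prop :=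
  ∀ φ : MSOForm ι, φ.IsSentence → φ.qr ≤ m → (M.Sat φ ↔ N.Sat φ)

/-- `M` and `N` agree on all MSO sentences. -/
def MSOEq {ι : Type u} (M N : MStr ι) : Prop :=
  ∀ φ : MSOForm ι, φ.IsSentence → (M.Sat φ ↔ N.Sat φ)

/-- `M ≡^FO_q N` over a purely monadic vocabulary: `M` and `N` agree on all
first-order sentences (not mentioning `E`) of quantifier rank at most `q`. -/
def FOEquiv {ι : Type u} (q : ℕ) (M N : MStr ι) : Prop :=
  ∀ φ : MSOForm ι, φ.IsFO → φ.NoEdge → φ.IsSentence → φ.qr ≤ q → (M.Sat φ ↔ N.Sat φ)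

end MStr

/-- A (finite or infinite) `p`-labeled rooted tree: a structure over the vocabulary
`{E, root, P_1, …, P_p}` whose `{E}`-reduct is a tree (connected acyclic graph),
with a distinguished root and every node carrying exactly one label from `Fin p`. -/
structure PTree (p : ℕ) where
  V : Type
  g : SimpleGraph V
  tree : g.IsTree
  root : V
  label : V → Fin p

namespace PTree

variable {p : ℕ}

/-- The tree has height at most `d` (every node is within distance `d` of the root). -/
def heightLe (t : PTree p) (d : ℕ) : Prop := ∀ v, t.g.dist t.root v ≤ d

/-- The tree has height exactly `h`. -/
def heightIs (t : PTree p) (h : ℕ) : Prop :=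
  (∀ v, t.g.dist t.root v ≤ h) ∧ ∃ v, t.g.dist t.root v = h

/-- A `p`-labeled rooted tree as a structure over the vocabulary
`{E, root, P_1, …, P_p}` (`none` indexing the `root` predicate). -/
def toStr (t : PTree p) : MStr (Option (Fin p)) :=
  ⟨t.V, t.g.Adj, fun o v =>
    match o with
    | none => v = t.root
    | some j => t.label v = j⟩

/-- A leaf: a node with no child. -/
def IsLeaf (t : PTree p) (v : t.V) : Prop :=
  ¬ ∃ w, t.g.Adj v w ∧ t.g.dist t.root w = t.g.dist t.root v + 1

end PTree

/-- `t'` is a leaf-hereditary subtree of `t`: an induced subtree of `t` with the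
same root each of whose leaves is a leaf of `t`. -/
def LeafHereditary {p : ℕ} (t' t : PTree p) : Prop :=
  ∃ f : t'.V → t.V, Function.Injective f ∧
    (∀ a b, t'.g.Adj a b ↔ t.g.Adj (f a) (f b)) ∧
    f t'.root = t.root ∧ (∀ a, t.label (f a) = t'.label a) ∧
    ∀ a, t'.IsLeaf a → t.IsLeaf (f a)

/-- Two types have the same cardinality, or both have at least `T` elements. -/
def SameUpTo (T : ℕ) (X Y : Type) : Prop :=
  Nonempty (X ≃ Y) ∨ ((T : ℕ∞) ≤ ENat.card X ∧ (T : ℕ∞) ≤ ENat.card Y)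

/-- The cardinality of `X`, truncated at `T`. -/
noncomputable def capCard (T : ℕ) (X : Type) : Fin (T + 1) :=
  ⟨(min (T : ℕ∞) (ENat.card X)).toNat, by
    have h : (min (T : ℕ∞) (ENat.card X)).toNat ≤ ((T : ℕ∞)).toNat :=
      ENat.toNat_le_toNat (min_le_left _ _) (ENat.natCast_ne_top T)
    rw [ENat.toNat_natCast] at h
    omega⟩

theorem capCard_eq_iff {T : ℕ} {X Y : Type} : capCard T X = capCard T Y ↔ SameUpTo T X Y := by
  have hX : min (T : ℕ∞) (ENat.card X) ≠ ⊤ :=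
    ((min_le_left _ _).trans_lt (ENat.natCast_lt_top T)).ne
  have hY : min (T : ℕ∞) (ENat.card Y) ≠ ⊤ :=
    ((min_le_left _ _).trans_lt (ENat.natCast_lt_top T)).ne
  constructor
  · intro h
    have h' : min (T : ℕ∞) (ENat.card X) = min (T : ℕ∞) (ENat.card Y) := by
      rw [← ENat.natCast_toNat hX, ← ENat.natCast_toNat hY]
      exact congrArg Nat.cast (Fin.ext_iff.mp h)
    by_cases hTX : (T : ℕ∞) ≤ ENat.card X
    · rw [min_eq_left hTX] at h'
      exact Or.inr ⟨hTX, h' ▸ min_le_right _ _⟩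
    · have hlt : ENat.card X < T := not_le.mp hTX
      rw [min_eq_right hlt.le] at h'
      have hYT : ENat.card Y < T := by
        by_contra hc
        rw [min_eq_left (not_lt.mp hc)] at h'
        exact hlt.ne h'
      rw [min_eq_right hYT.le] at h'
      have : Finite X := ENat.card_lt_top.mp (hlt.trans (ENat.natCast_lt_top T))
      have : Finite Y := ENat.card_lt_top.mp (hYT.trans (ENat.natCast_lt_top T))
      refine Or.inl ?_
      rw [ENat.card_eq_coe_natCard, ENat.card_eq_coe_natCard] at h'
      exact Finite.card_eq.mp (by exact_mod_cast h')
  · rintro (⟨⟨e⟩⟩ | ⟨h₁, h₂⟩)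
    · simp only [capCard, ENat.card_congr e]
    · simp only [capCard, min_eq_left h₁, min_eq_left h₂]

theorem SameUpTo.symm {T : ℕ} {X Y : Type} (h : SameUpTo T X Y) : SameUpTo T Y X :=
  h.imp (fun ⟨e⟩ => ⟨e.symm⟩) And.symm

theorem SameUpTo.nonempty {T : ℕ} (hT : 1 ≤ T) {X Y : Type} (h : SameUpTo T X Y)
    (hX : Nonempty X) : Nonempty Y := by
  rcases h with ⟨⟨e⟩⟩ | ⟨-, h⟩
  · exact hX.map e
  · rw [← ENat.card_pos_iff_nonempty]
    exact lt_of_lt_of_le (by exact_mod_cast hT) h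

theorem SameUpTo.nontrivial {T : ℕ} (hT : 2 ≤ T) {X Y : Type} (h : SameUpTo T X Y)
    (hX : Nontrivial X) : Nontrivial Y := by
  rcases h with ⟨⟨e⟩⟩ | ⟨-, h⟩
  · exact e.symm.nontrivial
  · rw [← ENat.one_lt_card_iff_nontrivial]
    exact lt_of_lt_of_le (by exact_mod_cast hT) h

theorem SameUpTo.sigma {T : ℕ} {A : Type} {X Y : A → Type} (h : ∀ a, SameUpTo T (X a) (Y a)) :
    SameUpTo T (Σ a, X a) (Σ a, Y a) := by
  by_cases hl : ∃ a, (T : ℕ∞) ≤ ENat.card (X a) ∧ (T : ℕ∞) ≤ ENat.card (Y a)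
  · obtain ⟨a, h₁, h₂⟩ := hl
    exact Or.inr ⟨h₁.trans (ENat.card_le_card_of_injective (sigma_mk_injective (i := a))),
      h₂.trans (ENat.card_le_card_of_injective (sigma_mk_injective (i := a)))⟩
  · have h' : ∀ a, Nonempty (X a ≃ Y a) := fun a =>
      (h a).resolve_right fun hc => hl ⟨a, hc⟩
    exact Or.inl ⟨Equiv.sigmaCongrRight fun a => (h' a).some⟩

theorem SameUpTo.of_equiv {T : ℕ} {X X' Y Y' : Type} (e : X ≃ X') (e' : Y ≃ Y')
    (h : SameUpTo T X' Y') : SameUpTo T X Y := by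
  rcases h with ⟨⟨f⟩⟩ | ⟨h₁, h₂⟩
  · exact Or.inl ⟨e.trans (f.trans e'.symm)⟩
  · exact Or.inr ⟨by rwa [ENat.card_congr e], by rwa [ENat.card_congr e']⟩

/-- A set has a finite subset that is either of size `T` or everything, of size at most `T`. -/
theorem exists_finset_capped {X : Type} (T : ℕ) (P : X → Prop) :
    ∃ Y : Finset X, (∀ x ∈ Y, P x) ∧ Y.card ≤ T ∧
      (Y.card = T ∨ ∀ x, P x → x ∈ Y) := by
  by_cases h : (T : ℕ∞) ≤ {x | P x}.encard
  · obtain ⟨Y, hY, hc⟩ := Set.exists_subset_encard_eq h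
    have hf : Y.Finite := Set.finite_of_encard_eq_coe hc
    have hcard : hf.toFinset.card = T := by
      have := hf.encard_eq_coe_toFinset_card
      rw [hc] at this
      exact_mod_cast this.symm
    exact ⟨hf.toFinset, fun x hx => hY (hf.mem_toFinset.mp hx), hcard.le, Or.inl hcard⟩
  · have hlt := not_le.mp h
    have hf : {x | P x}.Finite := Set.encard_lt_top_iff.mp (hlt.trans (ENat.natCast_lt_top T))
    refine ⟨hf.toFinset, fun x hx => hf.mem_toFinset.mp hx, ?_, Or.inr fun x hx =>
      hf.mem_toFinset.mpr hx⟩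
    rw [hf.encard_eq_coe_toFinset_card] at hlt
    exact_mod_cast hlt.le

theorem sameUpTo_of_finset_capped {X : Type} {T : ℕ} {P : X → Prop} {Y : Finset X}
    (h₁ : ∀ x ∈ Y, P x) (h₂ : Y.card = T ∨ ∀ x, P x → x ∈ Y) :
    SameUpTo T {x // x ∈ Y} {x // P x} := by
  rcases h₂ with h₂ | h₂
  · have hY : (T : ℕ∞) ≤ ENat.card {x // x ∈ Y} := by simp [h₂]
    exact Or.inr ⟨hY, hY.trans (ENat.card_le_card_of_injective
      (Subtype.map_injective h₁ Function.injective_id))⟩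
  · exact Or.inl ⟨Equiv.subtypeEquivRight fun x => ⟨h₁ x, h₂ x⟩⟩

/-- A partition of `X` can be transported to any `X'` which is the same up to a large threshold. -/
theorem exists_transport {X X' B : Type} [Finite B] [Nonempty B] {T : ℕ} (hT : 1 ≤ T)
    (h : SameUpTo (T * Nat.card B) X X') (σ : X → B) :
    ∃ f : X' → X, ∀ b, SameUpTo T {x // σ x = b} {x' // σ (f x') = b} := by
  classical
  have := Fintype.ofFinite B
  rcases h with ⟨⟨e⟩⟩ | ⟨hX, hX'⟩
  · refine ⟨e.symm, fun b => Or.inl ⟨e.subtypeEquiv fun x => by simp⟩⟩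
  · choose Y hYσ hYT hY using fun b => exists_finset_capped T (fun x => σ x = b)
    have hcard : (Finset.univ.biUnion Y).card ≤ T * Nat.card B := by
      rw [Nat.card_eq_fintype_card, mul_comm]
      exact Finset.card_biUnion_le_card_mul _ _ _ fun b _ => hYT b
    have hmem : ∀ x, x ∈ Finset.univ.biUnion Y ↔ x ∈ Y (σ x) := by
      intro x
      simp only [Finset.mem_biUnion, Finset.mem_univ, true_and]
      exact ⟨fun ⟨b, hb⟩ => by rwa [hYσ b x hb], fun hx => ⟨_, hx⟩⟩
    have hbig : ∃ b, (Y b).card = T := by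
      by_contra! hc
      have hall : ∀ x, x ∈ Finset.univ.biUnion Y := fun x =>
        (hmem x).mpr ((hY _).resolve_left (hc _) x rfl)
      have hlt : (Finset.univ.biUnion Y).card < T * Nat.card B := by
        refine Finset.card_biUnion_le.trans_lt ?_
        calc ∑ b, (Y b).card < ∑ _b : B, T :=
              Finset.sum_lt_sum_of_nonempty Finset.univ_nonempty fun b _ =>
                lt_of_le_of_ne (hYT b) (hc b)
          _ = T * Nat.card B := by simp [mul_comm]
      have : ENat.card X ≤ (Finset.univ.biUnion Y).card := by
        rw [← Set.encard_univ, ← Set.encard_coe_eq_coe_finsetCard]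
        exact Set.encard_le_encard fun x _ => hall x
      have := hX.trans this
      norm_cast at this
      omega
    obtain ⟨b₀, hb₀⟩ := hbig
    obtain ⟨x₀, hx₀⟩ : (Y b₀).Nonempty := Finset.card_pos.mp (by omega)
    have hle : ((Finset.univ.biUnion Y).card : ℕ∞) ≤ (Set.univ : Set X').encard := by
      rw [Set.encard_univ]
      exact le_trans (by exact_mod_cast hcard) hX'
    obtain ⟨Z, -, hZ⟩ := Set.exists_subset_encard_eq hle
    have hZf : Z.Finite := Set.finite_of_encard_eq_coe hZ
    have hZc : Nat.card Z = Nat.card {x // x ∈ Finset.univ.biUnion Y} := by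
      have : Z.ncard = (Finset.univ.biUnion Y).card := by simp [Set.ncard, hZ]
      rw [Nat.card_coe_set_eq, this, Nat.card_eq_fintype_card, Fintype.card_coe]
    have := hZf.to_subtype
    let e : Z ≃ {x // x ∈ Finset.univ.biUnion Y} := (Finite.card_eq.mp hZc).some
    let f : X' → X := fun x' => if hx : x' ∈ Z then (e ⟨x', hx⟩).1 else x₀
    have hf : ∀ x' (hx : x' ∈ Z), f x' = (e ⟨x', hx⟩).1 := fun x' hx => dif_pos hx
    have hf' : ∀ x', x' ∉ Z → f x' = x₀ := fun x' hx => dif_neg hx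
    have hg : ∀ y : {x // x ∈ Finset.univ.biUnion Y}, f (e.symm y).1 = y.1 := fun y => by
      rw [hf _ (e.symm y).2]; simp
    refine ⟨f, fun b => ?_⟩
    by_cases hb : (Y b).card = T
    · have hTY : (T : ℕ∞) ≤ ENat.card {x // x ∈ Y b} := by simp [hb]
      refine Or.inr ⟨hTY.trans (ENat.card_le_card_of_injective
        (Subtype.map_injective (hYσ b) Function.injective_id)), hTY.trans ?_⟩
      have hin : ∀ y : {x // x ∈ Y b}, y.1 ∈ Finset.univ.biUnion Y := fun y =>
        Finset.mem_biUnion.mpr ⟨b, Finset.mem_univ _, y.2⟩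
      refine ENat.card_le_card_of_injective
        (f := fun y => (⟨(e.symm ⟨y.1, hin y⟩).1, by rw [hg]; exact hYσ b _ y.2⟩ :
          {x' // σ (f x') = b})) ?_
      intro y z hyz
      have h1 := congrArg (fun w : {x' // σ (f x') = b} => f w.1) hyz
      simp only [hg] at h1
      exact Subtype.ext h1
    · have hall := (hY b).resolve_left hb
      have hZmem : ∀ x', σ (f x') = b → x' ∈ Z := by
        intro x' hx'
        by_contra hc
        rw [hf' _ hc, hYσ b₀ x₀ hx₀] at hx'
        exact hb (hx' ▸ hb₀)
      refine Or.inl ⟨{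
        toFun := fun x => ⟨(e.symm ⟨x.1, (hmem _).mpr (by rw [x.2]; exact hall _ x.2)⟩).1, by
          rw [hg]; exact x.2⟩
        invFun := fun x' => ⟨f x'.1, x'.2⟩
        left_inv := fun x => Subtype.ext (hg _)
        right_inv := fun x' => Subtype.ext ?_ }⟩
      have : (⟨f x'.1, (hmem _).mpr (by rw [x'.2]; exact hall _ x'.2)⟩ :
          {x // x ∈ Finset.univ.biUnion Y}) = e ⟨x'.1, hZmem _ x'.2⟩ :=
        Subtype.ext (hf _ _)
      simp [this]

/-- The equivalence splitting a fibre of `σ` according to a second map `κ`. -/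
def fiberSigmaEquiv {X A : Type} (κ : X → A) (P : ∀ a, {x // κ x = a} → Prop) :
    {x // P (κ x) ⟨x, rfl⟩} ≃ Σ a, {y : {x // κ x = a} // P a y} where
  toFun x := ⟨κ x.1, ⟨⟨x.1, rfl⟩, x.2⟩⟩
  invFun y := ⟨y.2.1.1, by
    obtain ⟨_, ⟨⟨x, rfl⟩, h⟩⟩ := y
    exact h⟩
  left_inv _ := rfl
  right_inv := by
    rintro ⟨_, ⟨⟨x, rfl⟩, h⟩⟩
    rfl

theorem exists_transport_over {X X' A B : Type} [Finite B] [Nonempty B] {T : ℕ} (hT : 1 ≤ T)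
    (κ : X → A) (κ' : X' → A)
    (h : ∀ a, SameUpTo (T * Nat.card B) {x // κ x = a} {x' // κ' x' = a}) (σ : X → B) :
    ∃ f : X' → X, (∀ x', κ (f x') = κ' x') ∧
      ∀ b, SameUpTo T {x // σ x = b} {x' // σ (f x') = b} := by
  choose f hf using fun a => exists_transport hT (h a) (fun x => σ x.1)
  refine ⟨fun x' => (f (κ' x') ⟨x', rfl⟩).1, fun x' => (f (κ' x') ⟨x', rfl⟩).2, fun b => ?_⟩
  exact (SameUpTo.sigma fun a => hf a b).of_equiv
    (fiberSigmaEquiv κ fun _ y => σ y.1 = b)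
    (fiberSigmaEquiv κ' fun a y => σ (f a y).1 = b)

/-- A rooted forest, given by its parent-to-child relation and a depth function. -/
structure RootedForest (V : Type) where
  child : V → V → Prop
  depth : V → ℕ
  depth_child : ∀ {u w}, child u w → depth w = depth u + 1
  parent_unique : ∀ {u u' w}, child u w → child u' w → u = u'

/-- The truncated counting types of trees of height at most `h` whose nodes are coloured by `C`,
where the types of the subtrees of height `i` are counted up to the threshold `T i`. -/
def TreeType (C : Type) (T : ℕ → ℕ) : ℕ → Type
  | 0 => C
  | h + 1 => C × (TreeType C T h → Fin (T h + 1))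

/-- The number of truncated counting types over a set of `n` colours. -/
def typeCount (n : ℕ) (T : ℕ → ℕ) : ℕ → ℕ
  | 0 => n
  | h + 1 => n * (T h + 1) ^ typeCount n T h

theorem TreeType.finite (C : Type) [Finite C] (T : ℕ → ℕ) : ∀ h, Finite (TreeType C T h)
  | 0 => inferInstanceAs (Finite C)
  | h + 1 =>
    have := TreeType.finite C T h
    inferInstanceAs (Finite (C × (TreeType C T h → Fin (T h + 1))))

instance (C : Type) [Finite C] (T : ℕ → ℕ) (h : ℕ) : Finite (TreeType C T h) :=
  TreeType.finite C T h

instance (C : Type) [Nonempty C] (T : ℕ → ℕ) : ∀ h, Nonempty (TreeType C T h)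
  | 0 => inferInstanceAs (Nonempty C)
  | h + 1 => inferInstanceAs (Nonempty (C × (TreeType C T h → Fin (T h + 1))))

theorem TreeType.natCard (C : Type) [Finite C] (T : ℕ → ℕ) :
    ∀ h, Nat.card (TreeType C T h) = typeCount (Nat.card C) T h
  | 0 => rfl
  | h + 1 => by
    change Nat.card (C × (TreeType C T h → Fin (T h + 1))) = _
    rw [Nat.card_prod, Nat.card_fun, TreeType.natCard C T h, Nat.card_fin]
    rfl

namespace RootedForest

variable {V V' C : Type}

/-- The descendants of a node, including the node itself. -/
def desc (F : RootedForest V) (u : V) : Set V := {x | Relation.ReflTransGen F.child u x}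

theorem mem_desc_self (F : RootedForest V) (u : V) : u ∈ F.desc u := Relation.ReflTransGen.refl

theorem desc_trans {F : RootedForest V} {u v w : V} (h₁ : v ∈ F.desc u) (h₂ : w ∈ F.desc v) :
    w ∈ F.desc u := Relation.ReflTransGen.trans h₁ h₂

theorem mem_desc_of_child {F : RootedForest V} {u w : V} (h : F.child u w) : w ∈ F.desc u :=
  Relation.ReflTransGen.single h

theorem mem_desc_iff {F : RootedForest V} {u x : V} :
    x ∈ F.desc u ↔ x = u ∨ ∃ w, F.child u w ∧ x ∈ F.desc w := by
  rw [eq_comm]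
  exact Relation.ReflTransGen.cases_head_iff

theorem depth_le_of_mem_desc {F : RootedForest V} {u x : V} (h : x ∈ F.desc u) :
    F.depth u ≤ F.depth x := by
  induction h with
  | refl => exact le_rfl
  | tail _ h ih => have := F.depth_child h; omega

theorem eq_of_mem_desc {F : RootedForest V} {u w x : V} (hu : x ∈ F.desc u) (hw : x ∈ F.desc w)
    (hd : F.depth u = F.depth w) : u = w := by
  induction hu with
  | refl =>
    rcases Relation.ReflTransGen.cases_tail hw with h | ⟨y, hy, hyx⟩
    · exact h
    · have := depth_le_of_mem_desc hy
      have := F.depth_child hyx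
      omega
  | @tail y x hy hyx ih =>
    rcases Relation.ReflTransGen.cases_tail hw with h | ⟨z, hz, hzx⟩
    · have := depth_le_of_mem_desc hy
      have := F.depth_child hyx
      subst h
      omega
    · obtain rfl := F.parent_unique hzx hyx
      exact ih hz

theorem eq_of_child_of_mem_desc {F : RootedForest V} {u w₁ w₂ x : V} (h₁ : F.child u w₁)
    (h₂ : F.child u w₂) (hx₁ : x ∈ F.desc w₁) (hx₂ : x ∈ F.desc w₂) : w₁ = w₂ :=
  eq_of_mem_desc hx₁ hx₂ ((F.depth_child h₁).trans (F.depth_child h₂).symm)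

theorem not_mem_desc_of_child {F : RootedForest V} {u w : V} (h : F.child u w) :
    u ∉ F.desc w := fun hu => by
  have := depth_le_of_mem_desc hu
  have := F.depth_child h
  omega

/-- The subtree below `u` has height at most `h`. -/
def HeightLe (F : RootedForest V) (h : ℕ) (u : V) : Prop :=
  ∀ x ∈ F.desc u, F.depth x ≤ F.depth u + h

theorem HeightLe.of_child {F : RootedForest V} {h : ℕ} {u w : V} (hu : F.HeightLe (h + 1) u)
    (hw : F.child u w) : F.HeightLe h w := fun x hx => by
  have := hu x (desc_trans (mem_desc_of_child hw) hx)
  have := F.depth_child hw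
  omega

theorem HeightLe.not_child {F : RootedForest V} {u w : V} (hu : F.HeightLe 0 u) :
    ¬ F.child u w := fun hw => by
  have := hu w (mem_desc_of_child hw)
  have := F.depth_child hw
  omega

/-- The truncated counting type of the subtree of height `h` below a node. -/
noncomputable def ty (F : RootedForest V) (T : ℕ → ℕ) (c : V → C) : (h : ℕ) → V → TreeType C T h
  | 0, u => c u
  | h + 1, u => (c u, fun a => capCard (T h) {w : {w // F.child u w} // F.ty T c h w.1 = a})

section

variable {F : RootedForest V} {F' : RootedForest V'} {T : ℕ → ℕ} {c : V → C} {c' : V' → C}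

theorem ty_succ_eq_iff {h : ℕ} {u : V} {u' : V'} :
    F.ty T c (h + 1) u = F'.ty T c' (h + 1) u' ↔ c u = c' u' ∧
      ∀ a, SameUpTo (T h) {w : {w // F.child u w} // F.ty T c h w.1 = a}
        {w : {w // F'.child u' w} // F'.ty T c' h w.1 = a} := by
  simp only [ty, TreeType, Prod.mk.injEq, funext_iff, capCard_eq_iff]

theorem color_eq_of_ty_eq {h : ℕ} {u : V} {u' : V'} (e : F.ty T c h u = F'.ty T c' h u') :
    c u = c' u' := by
  cases h with
  | zero => exact e
  | succ h => exact (ty_succ_eq_iff.mp e).1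

/-- Types are invariant under maps that are bijective on the children of each node. -/
theorem ty_congr (f : V' → V) (hf : Function.Injective f) (D : Set V')
    (hD : ∀ u ∈ D, ∀ w, F'.child u w → w ∈ D ∧ F.child (f u) (f w))
    (hD' : ∀ u ∈ D, ∀ y, F.child (f u) y → ∃ w, F'.child u w ∧ f w = y)
    (hc : ∀ u ∈ D, c' u = c (f u)) :
    ∀ h, ∀ u ∈ D, F'.ty T c' h u = F.ty T c h (f u) := by
  intro h
  induction h with
  | zero => exact hc
  | succ h ih =>
    intro u hu
    refine ty_succ_eq_iff.mpr ⟨hc u hu, fun a => Or.inl ⟨Equiv.ofBijective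
      (fun w => ⟨⟨f w.1.1, (hD u hu _ w.1.2).2⟩, by
        rw [← ih _ (hD u hu _ w.1.2).1]; exact w.2⟩) ⟨?_, ?_⟩⟩⟩
    · intro w₁ w₂ e
      simp only [Subtype.mk.injEq] at e
      exact Subtype.ext (Subtype.ext (hf e))
    · rintro ⟨⟨y, hy⟩, hya⟩
      obtain ⟨w, hw, rfl⟩ := hD' u hu y hy
      exact ⟨⟨⟨w, hw⟩, by rw [ih _ (hD u hu w hw).1]; exact hya⟩, rfl⟩

theorem exists_child_of_ty_eq {h : ℕ} (hT : 1 ≤ T h) {u : V} {u' : V'}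
    (e : F.ty T c (h + 1) u = F'.ty T c' (h + 1) u') {w : V} (hw : F.child u w) :
    ∃ w', F'.child u' w' ∧ F.ty T c h w = F'.ty T c' h w' := by
  obtain ⟨⟨⟨w', hw'⟩, h'⟩⟩ := ((ty_succ_eq_iff.mp e).2 (F.ty T c h w)).nonempty hT
    ⟨⟨⟨w, hw⟩, rfl⟩⟩
  exact ⟨w', hw', h'.symm⟩

theorem exists_children_of_ty_eq {h : ℕ} (hT : 2 ≤ T h) {u : V} {u' : V'}
    (e : F.ty T c (h + 1) u = F'.ty T c' (h + 1) u') {w₁ w₂ : V} (hw₁ : F.child u w₁)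
    (hw₂ : F.child u w₂) (hne : w₁ ≠ w₂) :
    ∃ w₁' w₂', F'.child u' w₁' ∧ F'.child u' w₂' ∧ w₁' ≠ w₂' ∧
      F.ty T c h w₁ = F'.ty T c' h w₁' ∧ F.ty T c h w₂ = F'.ty T c' h w₂' := by
  by_cases heq : F.ty T c h w₁ = F.ty T c h w₂
  · obtain ⟨⟨⟨⟨w₁', hw₁'⟩, h₁⟩, ⟨⟨w₂', hw₂'⟩, h₂⟩, hne'⟩⟩ :=
      ((ty_succ_eq_iff.mp e).2 (F.ty T c h w₁)).nontrivial hT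
        ⟨⟨⟨w₁, hw₁⟩, rfl⟩, ⟨⟨w₂, hw₂⟩, heq.symm⟩, fun hc => hne (by simpa using hc)⟩
    exact ⟨w₁', w₂', hw₁', hw₂', fun hc => hne' (by simpa using hc), h₁.symm,
      heq.symm.trans h₂.symm⟩
  · obtain ⟨w₁', hw₁', h₁⟩ := exists_child_of_ty_eq (by omega) e hw₁
    obtain ⟨w₂', hw₂', h₂⟩ := exists_child_of_ty_eq (by omega) e hw₂
    exact ⟨w₁', w₂', hw₁', hw₂', fun hc => heq (by rw [h₁, h₂, hc]), h₁, h₂⟩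

theorem exists_color_of_ty_eq (hT : ∀ i, 1 ≤ T i) {h : ℕ} {u : V} {u' : V'}
    (hu : F.HeightLe h u) (e : F.ty T c h u = F'.ty T c' h u') {x : V} (hx : x ∈ F.desc u) :
    ∃ x' ∈ F'.desc u', c' x' = c x := by
  induction h generalizing u u' with
  | zero =>
    rcases mem_desc_iff.mp hx with rfl | ⟨w, hw, -⟩
    · exact ⟨u', F'.mem_desc_self u', (color_eq_of_ty_eq e).symm⟩
    · exact (hu.not_child hw).elim
  | succ h ih =>
    rcases mem_desc_iff.mp hx with rfl | ⟨w, hw, hxw⟩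
    · exact ⟨u', F'.mem_desc_self u', (color_eq_of_ty_eq e).symm⟩
    · obtain ⟨w', hw', e'⟩ := exists_child_of_ty_eq (hT h) e hw
      obtain ⟨x', hx', hc⟩ := ih (hu.of_child hw) e' hxw
      exact ⟨x', desc_trans (mem_desc_of_child hw') hx', hc⟩

theorem exists_child_color_of_ty_eq (hT : ∀ i, 1 ≤ T i) {h : ℕ} {u : V} {u' : V'}
    (hu : F.HeightLe h u) (e : F.ty T c h u = F'.ty T c' h u') {x y : V} (hx : x ∈ F.desc u)
    (hxy : F.child x y) : ∃ x' y', F'.child x' y' ∧ c' x' = c x ∧ c' y' = c y := by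
  induction h generalizing u u' with
  | zero =>
    rcases mem_desc_iff.mp hx with rfl | ⟨w, hw, -⟩
    · exact (hu.not_child hxy).elim
    · exact (hu.not_child hw).elim
  | succ h ih =>
    rcases mem_desc_iff.mp hx with rfl | ⟨w, hw, hxw⟩
    · obtain ⟨w', hw', e'⟩ := exists_child_of_ty_eq (hT h) e hxy
      exact ⟨u', w', hw', (color_eq_of_ty_eq e).symm, (color_eq_of_ty_eq e').symm⟩
    · obtain ⟨w', hw', e'⟩ := exists_child_of_ty_eq (hT h) e hw
      exact ih (hu.of_child hw) e' hxw

theorem color_subsingleton_of_ty_eq (hT : ∀ i, 2 ≤ T i) {h : ℕ} {u : V} {u' : V'}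
    (hu' : F'.HeightLe h u') (e : F.ty T c h u = F'.ty T c' h u')
    (Q : Set C) (hQ : ∀ x ∈ F.desc u, ∀ y ∈ F.desc u, c x ∈ Q → c y ∈ Q → x = y) :
    ∀ x ∈ F'.desc u', ∀ y ∈ F'.desc u', c' x ∈ Q → c' y ∈ Q → x = y := by
  induction h generalizing u u' with
  | zero =>
    intro x hx y hy _ _
    rcases mem_desc_iff.mp hx with rfl | ⟨w, hw, -⟩
    · rcases mem_desc_iff.mp hy with rfl | ⟨w, hw, -⟩
      · rfl
      · exact (hu'.not_child hw).elim
    · exact (hu'.not_child hw).elim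
  | succ h ih =>
    have hT1 : ∀ i, 1 ≤ T i := fun i => one_le_two.trans (hT i)
    have hroot : ∀ w', F'.child u' w' → ∀ x ∈ F'.desc w', c' u' ∈ Q → c' x ∉ Q := by
      intro w' hw' x hx huQ hxQ
      obtain ⟨w, hw, e'⟩ := exists_child_of_ty_eq (hT1 h) e.symm hw'
      obtain ⟨z, hz, hzc⟩ := exists_color_of_ty_eq hT1 (hu'.of_child hw') e' hx
      have := hQ u (F.mem_desc_self u) z (desc_trans (mem_desc_of_child hw) hz)
        (by rwa [color_eq_of_ty_eq e]) (by rwa [hzc])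
      exact not_mem_desc_of_child hw (this ▸ hz)
    intro x hx y hy hxQ hyQ
    rcases mem_desc_iff.mp hx with rfl | ⟨w₁, hw₁, hxw₁⟩ <;>
      rcases mem_desc_iff.mp hy with rfl | ⟨w₂, hw₂, hyw₂⟩
    · rfl
    · exact (hroot w₂ hw₂ y hyw₂ hxQ hyQ).elim
    · exact (hroot w₁ hw₁ x hxw₁ hyQ hxQ).elim
    · by_cases hne : w₁ = w₂
      · subst hne
        obtain ⟨w, hw, e'⟩ := exists_child_of_ty_eq (hT1 h) e.symm hw₁
        refine ih (hu'.of_child hw₁) e'.symm (fun x hx y hy => ?_) x hxw₁ y hyw₂ hxQ hyQ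
        exact hQ x (desc_trans (mem_desc_of_child hw) hx) y
          (desc_trans (mem_desc_of_child hw) hy)
      · obtain ⟨z₁, z₂, hz₁, hz₂, hz, e₁, e₂⟩ :=
          exists_children_of_ty_eq (hT h) e.symm hw₁ hw₂ hne
        obtain ⟨x₁, hx₁, hc₁⟩ := exists_color_of_ty_eq hT1 (hu'.of_child hw₁) e₁ hxw₁
        obtain ⟨x₂, hx₂, hc₂⟩ := exists_color_of_ty_eq hT1 (hu'.of_child hw₂) e₂ hyw₂
        have := hQ x₁ (desc_trans (mem_desc_of_child hz₁) hx₁) x₂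
          (desc_trans (mem_desc_of_child hz₂) hx₂) (by rwa [hc₁]) (by rwa [hc₂])
        subst this
        exact (hz (eq_of_child_of_mem_desc hz₁ hz₂ hx₁ hx₂)).elim

theorem ty_congr_color {c₁ c₂ : V → C} {h : ℕ} {u : V} (hc : ∀ x ∈ F.desc u, c₁ x = c₂ x) :
    F.ty T c₁ h u = F.ty T c₂ h u :=
  ty_congr id Function.injective_id (F.desc u)
    (fun _ hx _ hxy => ⟨desc_trans hx (mem_desc_of_child hxy), hxy⟩)
    (fun _ _ y hy => ⟨y, hy, rfl⟩) hc h u (F.mem_desc_self u)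

/-- Back-and-forth step: a set of nodes on one side can be answered on the other side. -/
theorem exists_extension [Finite C] {T T' : ℕ → ℕ} (hT' : ∀ i, 1 ≤ T' i)
    (hT : ∀ i, T i = T' i * Nat.card (TreeType (C × Bool) T' i)) {h : ℕ} {u : V} {u' : V'}
    (heq : F.ty T c h u = F'.ty T c' h u') (e : V → Bool) :
    ∃ e' : V' → Bool, F.ty T' (fun x => (c x, e x)) h u =
      F'.ty T' (fun x => (c' x, e' x)) h u' := by
  classical
  have : Nonempty C := ⟨c u⟩
  induction h generalizing u u' with
  | zero =>
    refine ⟨fun _ => e u, ?_⟩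
    have := color_eq_of_ty_eq heq
    change (c u, e u) = (c' u', e u)
    rw [this]
  | succ h ih =>
    obtain ⟨hc, hcount⟩ := ty_succ_eq_iff.mp heq
    rw [hT h] at hcount
    obtain ⟨f, hf, hcount'⟩ := exists_transport_over (hT' h) _ _ hcount
      (fun w => F.ty T' (fun x => (c x, e x)) h w.1)
    choose g hg using fun w' => ih (hf w')
    have hex : ∃ e' : V' → Bool, e' u' = e u ∧
        ∀ w', ∀ x ∈ F'.desc w'.1, e' x = g w' x := by
      refine ⟨fun x => if hx : ∃ w' : {w // F'.child u' w}, x ∈ F'.desc w'.1 then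
        g hx.choose x else e u, dif_neg ?_, fun w' x hx => ?_⟩
      · rintro ⟨w', hw'⟩
        exact not_mem_desc_of_child w'.2 hw'
      · have hx' : ∃ w' : {w // F'.child u' w}, x ∈ F'.desc w'.1 := ⟨w', hx⟩
        have : hx'.choose = w' :=
          Subtype.ext (eq_of_child_of_mem_desc hx'.choose.2 w'.2 hx'.choose_spec hx)
        simp only [dif_pos hx', this]
    obtain ⟨e', he'u, he'⟩ := hex
    refine ⟨e', ty_succ_eq_iff.mpr ⟨by rw [hc, he'u], fun b => ?_⟩⟩
    refine (hcount' b).of_equiv (Equiv.refl _) (Equiv.subtypeEquivRight fun w' => ?_)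
    rw [hg w', ty_congr_color (c₁ := fun x => (c' x, e' x)) (c₂ := fun x => (c' x, g w' x))
      fun x hx => by rw [he' w' x hx]]

end

end RootedForest

/-- The size of a pruned tree of height at most `h` with `n` colours and thresholds `T`. -/
def prunedSize (n : ℕ) (T : ℕ → ℕ) : ℕ → ℕ
  | 0 => 1
  | h + 1 => typeCount n T h * (T h * prunedSize n T h) + 1

namespace RootedForest

variable {V C : Type}

/-- The subforest induced on a set of nodes. -/
def restrict (F : RootedForest V) (S : Set V) : RootedForest V where
  child u w := F.child u w ∧ w ∈ S
  depth := F.depth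
  depth_child h := F.depth_child h.1
  parent_unique h h' := F.parent_unique h.1 h'.1

/-- `S` is a subtree below `u` containing, along with each non-leaf, one of its children. -/
structure IsLeafHereditary (F : RootedForest V) (S : Set V) (u : V) : Prop where
  root_mem : u ∈ S
  subset_desc : S ⊆ F.desc u
  exists_parent : ∀ x ∈ S, x ≠ u → ∃ y ∈ S, F.child y x
  exists_child : ∀ x ∈ S, (∃ w, F.child x w) → ∃ w ∈ S, F.child x w

theorem exists_pruning [Finite C] (F : RootedForest V) {T : ℕ → ℕ} (hT : ∀ i, 1 ≤ T i)
    (c : V → C) (h : ℕ) (u : V) (hu : F.HeightLe h u) :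
    ∃ S : Finset V, F.IsLeafHereditary S u ∧ S.card ≤ prunedSize (Nat.card C) T h ∧
      (F.restrict S).ty T c h u = F.ty T c h u := by
  classical
  induction h generalizing u with
  | zero =>
    refine ⟨{u}, ⟨by simp, by simp [F.mem_desc_self], by simp, ?_⟩, by simp [prunedSize], rfl⟩
    rintro x hx ⟨w, hw⟩
    obtain rfl : x = u := by simpa using hx
    exact (hu.not_child hw).elim
  | succ h ih =>
    choose! S hS hcard hty using fun w (hw : F.child u w) => ih w (hu.of_child hw)
    choose W hW hWT hWall using fun a : TreeType C T h =>
      exists_finset_capped (T h) (fun w => F.child u w ∧ F.ty T c h w = a)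
    have := Fintype.ofFinite (TreeType C T h)
    let R : Finset V := insert u (Finset.univ.biUnion fun a => (W a).biUnion S)
    have hR : ∀ x, x ∈ R ↔ x = u ∨ ∃ a, ∃ w ∈ W a, x ∈ S w := fun x => by
      simp [R]
    have hchildmem : ∀ w, F.child u w → (w ∈ R ↔ w ∈ W (F.ty T c h w)) := by
      intro w hw
      rw [hR]
      constructor
      · rintro (rfl | ⟨a, v, hv, hwv⟩)
        · exact (not_mem_desc_of_child hw (F.mem_desc_self _)).elim
        · have hvu := (hW a v hv).1
          obtain rfl := eq_of_child_of_mem_desc hw hvu (F.mem_desc_self w)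
            ((hS v hvu).subset_desc hwv)
          rwa [(hW a w hv).2]
      · exact fun h' => Or.inr ⟨_, w, h', (hS w hw).root_mem⟩
    have hbelow : ∀ w, F.child u w → w ∈ R → ∀ y ∈ F.desc w, y ∈ R → y ∈ S w := by
      intro w hw hwR y hy hyR
      rcases (hR y).mp hyR with rfl | ⟨a, v, hv, hyv⟩
      · exact (not_mem_desc_of_child hw hy).elim
      · have hvu := (hW a v hv).1
        rwa [eq_of_child_of_mem_desc hw hvu hy ((hS v hvu).subset_desc hyv)]
    have hsub : ∀ w, F.child u w → w ∈ R → S w ⊆ R := fun w hw hwR y hy =>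
      (hR y).mpr (Or.inr ⟨_, w, (hchildmem w hw).mp hwR, hy⟩)
    have htyR : ∀ w, F.child u w → w ∈ R → (F.restrict R).ty T c h w = F.ty T c h w := by
      intro w hw hwR
      rw [← hty w hw]
      refine ty_congr id Function.injective_id (F.desc w) ?_ ?_ (fun _ _ => rfl) h w
        (F.mem_desc_self w)
      · rintro x hx y ⟨hxy, hyR⟩
        have hy := desc_trans hx (mem_desc_of_child hxy)
        exact ⟨hy, hxy, hbelow w hw hwR y hy hyR⟩
      · rintro x hx y ⟨hxy, hyS⟩
        exact ⟨y, ⟨hxy, hsub w hw hwR hyS⟩, rfl⟩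
    refine ⟨R, ⟨by simp [R], ?_, ?_, ?_⟩, ?_, ?_⟩
    · intro x hx
      rcases (hR x).mp hx with rfl | ⟨a, w, hw, hxw⟩
      · exact F.mem_desc_self _
      · have hwu := (hW a w hw).1
        exact desc_trans (mem_desc_of_child hwu) ((hS w hwu).subset_desc hxw)
    · intro x hx hxu
      obtain ⟨a, w, hw, hxw⟩ := ((hR x).mp hx).resolve_left hxu
      have hwu := (hW a w hw).1
      by_cases hxw' : x = w
      · exact ⟨u, (hR u).mpr (Or.inl rfl), hxw' ▸ hwu⟩
      · obtain ⟨y, hy, hyx⟩ := (hS w hwu).exists_parent x hxw hxw'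
        exact ⟨y, (hR y).mpr (Or.inr ⟨a, w, hw, hy⟩), hyx⟩
    · intro x hx hxc
      rcases (hR x).mp hx with rfl | ⟨a, w, hw, hxw⟩
      · obtain ⟨w, hw⟩ := hxc
        obtain ⟨v, hv⟩ : (W (F.ty T c h w)).Nonempty := by
          rcases hWall (F.ty T c h w) with h' | h'
          · exact Finset.card_pos.mp (h' ▸ hT h)
          · exact ⟨w, h' w ⟨hw, rfl⟩⟩
        have hvu := (hW _ v hv).1
        exact ⟨v, (hR v).mpr (Or.inr ⟨_, v, hv, (hS v hvu).root_mem⟩), hvu⟩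
      · have hwu := (hW a w hw).1
        obtain ⟨y, hy, hxy⟩ := (hS w hwu).exists_child x hxw hxc
        exact ⟨y, (hR y).mpr (Or.inr ⟨a, w, hw, hy⟩), hxy⟩
    · refine (Finset.card_insert_le _ _).trans (Nat.succ_le_succ ?_)
      rw [← TreeType.natCard, Nat.card_eq_fintype_card]
      refine Finset.card_biUnion_le_card_mul _ _ _ fun a _ => ?_
      refine (Finset.card_biUnion_le_card_mul _ _ _ fun w hw => hcard w (hW a w hw).1).trans ?_
      exact Nat.mul_le_mul_right _ (hWT a)
    · refine ty_succ_eq_iff.mpr ⟨rfl, fun a => ?_⟩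
      refine (sameUpTo_of_finset_capped (hW a) (hWall a)).of_equiv ?_ ?_
      · exact {
          toFun := fun w => ⟨w.1.1, by
            have h₁ := (hchildmem w.1.1 w.1.2.1).mp w.1.2.2
            have h₂ := w.2
            rw [htyR _ w.1.2.1 w.1.2.2] at h₂
            rwa [h₂] at h₁⟩
          invFun := fun w => ⟨⟨w.1, (hW a w.1 w.2).1, by
              rw [Finset.mem_coe, hchildmem _ (hW a w.1 w.2).1, (hW a w.1 w.2).2]
              exact w.2⟩, by
            have h₁ := hW a w.1 w.2
            rw [htyR _ h₁.1 (by rw [hchildmem _ h₁.1, h₁.2]; exact w.2)]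
            exact h₁.2⟩
          left_inv := fun _ => rfl
          right_inv := fun _ => rfl }
      · exact {
          toFun := fun w => ⟨w.1.1, w.1.2, w.2⟩
          invFun := fun w => ⟨⟨w.1, w.2.1⟩, w.2.2⟩
          left_inv := fun _ => rfl
          right_inv := fun _ => rfl }

end RootedForest

/-- Thresholds sufficient for `m` rounds of the set game over `n` colours. -/
def threshold : ℕ → ℕ → ℕ → ℕ
  | 0, _, _ => 2
  | m + 1, n, h => threshold m (n * 2) h * typeCount (n * 2) (threshold m (n * 2)) h

theorem typeCount_pos {n : ℕ} (hn : 1 ≤ n) (T : ℕ → ℕ) (h : ℕ) : 1 ≤ typeCount n T h := by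
  cases h with
  | zero => exact hn
  | succ h => exact Nat.mul_pos hn (Nat.pow_pos (Nat.succ_pos _))

theorem two_le_threshold (m : ℕ) {n : ℕ} (hn : 1 ≤ n) (h : ℕ) : 2 ≤ threshold m n h := by
  induction m generalizing n with
  | zero => exact le_rfl
  | succ m ih =>
    exact le_mul_of_le_of_one_le (ih (by omega)) (typeCount_pos (by omega) _ _)

namespace PTree

variable {p : ℕ}

/-- The parent-to-child relation and depth function of a labelled rooted tree. -/
noncomputable def forest (t : PTree p) : RootedForest t.V where
  child u w := t.g.Adj u w ∧ t.g.dist t.root w = t.g.dist t.root u + 1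
  depth := t.g.dist t.root
  depth_child h := h.2
  parent_unique := by
    rintro u u' w ⟨h, hd⟩ ⟨h', hd'⟩
    have key : ∀ v, t.g.Adj v w → t.g.dist t.root w = t.g.dist t.root v + 1 →
        ∃ q : t.g.Walk t.root w, q.IsPath ∧ q.penultimate = v := by
      intro v hv hvd
      obtain ⟨q, hq⟩ := t.tree.connected.exists_walk_length_eq_dist t.root v
      exact ⟨q.concat hv, (q.concat hv).isPath_of_length_eq_dist
        (by rw [SimpleGraph.Walk.length_concat, hq, hvd]), by simp⟩
    obtain ⟨q, hq, rfl⟩ := key u h hd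
    obtain ⟨q', hq', rfl⟩ := key u' h' hd'
    rw [(t.tree.existsUnique_path t.root w).unique hq hq']

theorem adj_iff (t : PTree p) {u w : t.V} :
    t.g.Adj u w ↔ t.forest.child u w ∨ t.forest.child w u := by
  constructor
  · intro h
    rcases t.tree.dist_eq_dist_add_one_of_adj t.root h with hd | hd
    · exact Or.inr ⟨h.symm, hd⟩
    · exact Or.inl ⟨h, hd⟩
  · rintro (h | h)
    · exact h.1
    · exact h.1.symm

theorem mem_desc_root (t : PTree p) (x : t.V) : x ∈ t.forest.desc t.root := by
  induction hn : t.g.dist t.root x generalizing x with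
  | zero =>
    rw [t.tree.connected.dist_eq_zero_iff.mp hn]
    exact t.forest.mem_desc_self _
  | succ n ih =>
    have hne : x ≠ t.root := by
      rintro rfl
      simp at hn
    obtain ⟨q, hq⟩ := t.tree.connected.exists_walk_length_eq_dist t.root x
    have hnil : ¬ q.Nil := fun h => hne h.eq.symm
    have hadj := q.adj_penultimate hnil
    have hlen : q.dropLast.length + 1 = q.length := by
      have := congrArg SimpleGraph.Walk.length (q.concat_dropLast hadj)
      rwa [SimpleGraph.Walk.length_concat] at this
    have hle := SimpleGraph.dist_le q.dropLast
    have hd : t.g.dist t.root x = t.g.dist t.root q.penultimate + 1 := by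
      rcases t.tree.dist_eq_dist_add_one_of_adj t.root hadj with h | h <;> omega
    exact RootedForest.desc_trans (ih q.penultimate (by omega))
      (RootedForest.mem_desc_of_child ⟨hadj, hd⟩)

theorem heightLe.forest {t : PTree p} {h : ℕ} (ht : t.heightLe h) :
    t.forest.HeightLe h t.root := fun x _ => (ht x).trans (Nat.le_add_left _ _)

/-- Trees of the same counting type satisfy the same MSO formulas, up to the quantifier rank
allowed by the thresholds, under assignments determined by the colours. -/
theorem realize_of_ty_eq (φ : MSOForm (Option (Fin p))) :
    ∀ (m : ℕ), φ.qr ≤ m → ∀ (C : Type) [Finite C] (t t' : PTree p) (h : ℕ),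
      t.heightLe h → t'.heightLe h → ∀ (c : t.V → C) (c' : t'.V → C),
      t.forest.ty (threshold m (Nat.card C)) c h t.root =
        t'.forest.ty (threshold m (Nat.card C)) c' h t'.root →
      (∃ ℓ : C → Fin p, (∀ x, ℓ (c x) = t.label x) ∧ ∀ x, ℓ (c' x) = t'.label x) →
      ∀ (v : ℕ → t.V) (v' : ℕ → t'.V) (s : ℕ → Set t.V) (s' : ℕ → Set t'.V),
      (∀ i ∈ φ.freeFO, ∃ Q : Set C, (∀ x, c x ∈ Q ↔ x = v i) ∧ ∀ x, c' x ∈ Q ↔ x = v' i) →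
      (∀ i ∈ φ.freeSO, ∃ Q : Set C, (∀ x, c x ∈ Q ↔ x ∈ s i) ∧ ∀ x, c' x ∈ Q ↔ x ∈ s' i) →
      t.toStr.Realize φ v s → t'.toStr.Realize φ v' s' := by
  have hthr : ∀ m (C : Type) [Finite C] (x : C) i, 2 ≤ threshold m (Nat.card C) i :=
    fun m C _ x i => two_le_threshold m (Nat.card_pos_iff.mpr ⟨⟨x⟩, inferInstance⟩) i
  have hpt : ∀ m (C : Type) [Finite C] (t t' : PTree p) (h : ℕ), t.heightLe h →
      ∀ (c : t.V → C) (c' : t'.V → C),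
      t.forest.ty (threshold m (Nat.card C)) c h t.root =
        t'.forest.ty (threshold m (Nat.card C)) c' h t'.root → ∀ x, ∃ x', c' x' = c x := by
    intro m C _ t t' h ht c c' hty x
    obtain ⟨x', -, hx'⟩ := RootedForest.exists_color_of_ty_eq
      (fun i => one_le_two.trans (hthr m C (c x) i)) ht.forest hty (t.mem_desc_root x)
    exact ⟨x', hx'⟩
  have hext : ∀ m (C : Type) [Finite C] (t t' : PTree p) (h : ℕ),
      ∀ (c : t.V → C) (c' : t'.V → C),
      t.forest.ty (threshold (m + 1) (Nat.card C)) c h t.root =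
        t'.forest.ty (threshold (m + 1) (Nat.card C)) c' h t'.root → ∀ e : t.V → Bool,
      ∃ e' : t'.V → Bool,
        t.forest.ty (threshold m (Nat.card (C × Bool))) (fun x => (c x, e x)) h t.root =
        t'.forest.ty (threshold m (Nat.card (C × Bool))) (fun x => (c' x, e' x)) h t'.root := by
    intro m C _ t t' h c c' hty e
    refine RootedForest.exists_extension
      (fun i => one_le_two.trans (hthr m (C × Bool) (c t.root, true) i)) (fun i => ?_) hty e
    rw [TreeType.natCard, Nat.card_prod, Nat.card_eq_fintype_card (α := Bool), Fintype.card_bool]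
    rfl
  induction φ with
  | fal => exact fun _ _ _ _ _ _ _ _ _ _ _ _ _ _ _ _ _ _ _ h => h
  | eq i j =>
    intro m _ C _ t t' h ht _ c c' hty _ v v' s s' hFO _ hr
    obtain ⟨Q, hQ, hQ'⟩ := hFO i (by simp [MSOForm.freeFO])
    obtain ⟨R, hR, hR'⟩ := hFO j (by simp [MSOForm.freeFO])
    obtain ⟨x', hx'⟩ := hpt m C t t' h ht c c' hty (v i)
    have h₁ : x' = v' i := (hQ' x').mp (hx' ▸ (hQ _).mpr rfl)
    have h₂ : x' = v' j := (hR' x').mp (hx' ▸ (hR _).mpr hr)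
    exact h₁.symm.trans h₂
  | edge i j =>
    intro m _ C _ t t' h ht _ c c' hty _ v v' s s' hFO _ hr
    obtain ⟨Q, hQ, hQ'⟩ := hFO i (by simp [MSOForm.freeFO])
    obtain ⟨R, hR, hR'⟩ := hFO j (by simp [MSOForm.freeFO])
    have hT := fun k => one_le_two.trans (hthr m C (c t.root) k)
    rcases t.adj_iff.mp hr with hr | hr
    · obtain ⟨x', y', hxy, hx, hy⟩ := RootedForest.exists_child_color_of_ty_eq hT ht.forest hty
        (t.mem_desc_root _) hr
      have h₁ : x' = v' i := (hQ' x').mp (hx ▸ (hQ _).mpr rfl)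
      have h₂ : y' = v' j := (hR' y').mp (hy ▸ (hR _).mpr rfl)
      exact t'.adj_iff.mpr (Or.inl (h₁ ▸ h₂ ▸ hxy))
    · obtain ⟨x', y', hxy, hx, hy⟩ := RootedForest.exists_child_color_of_ty_eq hT ht.forest hty
        (t.mem_desc_root _) hr
      have h₁ : x' = v' j := (hR' x').mp (hx ▸ (hR _).mpr rfl)
      have h₂ : y' = v' i := (hQ' y').mp (hy ▸ (hQ _).mpr rfl)
      exact t'.adj_iff.mpr (Or.inr (h₁ ▸ h₂ ▸ hxy))
  | pred a i =>
    intro m _ C _ t t' h ht _ c c' hty hℓ v v' s s' hFO _ hr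
    obtain ⟨Q, hQ, hQ'⟩ := hFO i (by simp [MSOForm.freeFO])
    cases a with
    | none =>
      have hr : v i = t.root := hr
      have hc := RootedForest.color_eq_of_ty_eq hty
      exact ((hQ' t'.root).mp (hc ▸ (hQ _).mpr hr.symm)).symm
    | some j =>
      have hr : t.label (v i) = j := hr
      obtain ⟨ℓ, hℓ, hℓ'⟩ := hℓ
      obtain ⟨x', hx'⟩ := hpt m C t t' h ht c c' hty (v i)
      have h₁ : x' = v' i := (hQ' x').mp (hx' ▸ (hQ _).mpr rfl)
      change t'.label (v' i) = j
      rw [← h₁, ← hℓ', hx', hℓ, hr]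
  | mem i X =>
    intro m _ C _ t t' h ht _ c c' hty _ v v' s s' hFO hSO hr
    obtain ⟨Q, hQ, hQ'⟩ := hFO i (by simp [MSOForm.freeFO])
    obtain ⟨R, hR, hR'⟩ := hSO X (by simp [MSOForm.freeSO])
    obtain ⟨x', hx'⟩ := hpt m C t t' h ht c c' hty (v i)
    have h₁ : x' = v' i := (hQ' x').mp (hx' ▸ (hQ _).mpr rfl)
    have h₂ : x' ∈ s' X := (hR' x').mp (hx' ▸ (hR _).mpr hr)
    change v' i ∈ s' X
    rwa [← h₁]
  | imp φ ψ ihφ ihψ =>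
    intro m hm C _ t t' h ht ht' c c' hty hℓ v v' s s' hFO hSO hr hφ
    have hm := max_le_iff.mp hm
    refine ihψ m hm.2 C t t' h ht ht' c c' hty hℓ v v' s s'
      (fun i hi => hFO i (Finset.mem_union_right _ hi))
      (fun i hi => hSO i (Finset.mem_union_right _ hi)) (hr ?_)
    obtain ⟨ℓ, hℓ, hℓ'⟩ := hℓ
    refine ihφ m hm.1 C t' t h ht' ht c' c hty.symm ⟨ℓ, hℓ', hℓ⟩ v' v s' s (fun i hi => ?_)
      (fun i hi => ?_) hφ
    · obtain ⟨Q, hQ, hQ'⟩ := hFO i (Finset.mem_union_left _ hi)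
      exact ⟨Q, hQ', hQ⟩
    · obtain ⟨Q, hQ, hQ'⟩ := hSO i (Finset.mem_union_left _ hi)
      exact ⟨Q, hQ', hQ⟩
  | exFO n φ ih =>
    classical
    rintro m hm C _ t t' h ht ht' c c' hty ⟨ℓ, hℓ, hℓ'⟩ v v' s s' hFO hSO ⟨(x : t.V), hx⟩
    obtain ⟨m, rfl⟩ : ∃ k, m = k + 1 := ⟨m - 1, by have : φ.qr + 1 ≤ m := hm; omega⟩
    obtain ⟨e', he'⟩ := hext m C t t' h c c' hty (fun y => decide (y = x))
    obtain ⟨x', hx'⟩ := hpt m (C × Bool) t t' h ht _ _ he' x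
    have hx'e : e' x' = true := (congrArg Prod.snd hx').trans (decide_eq_true rfl)
    have huniq : ∀ y, e' y = true ↔ y = x' := fun y => by
      refine ⟨fun hy => ?_, fun hy => hy ▸ hx'e⟩
      refine RootedForest.color_subsingleton_of_ty_eq
        (fun i => hthr m (C × Bool) (c t.root, true) i) ht'.forest he' {q | q.2 = true} ?_
        y (t'.mem_desc_root y) x' (t'.mem_desc_root x') hy hx'e
      intro a _ b _ ha hb
      have ha : a = x := by simpa using ha
      have hb : b = x := by simpa using hb
      exact ha.trans hb.symm
    refine ⟨x', ih m (Nat.le_of_succ_le_succ hm) (C × Bool) t t' h ht ht' _ _ he'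
      ⟨fun q => ℓ q.1, hℓ, hℓ'⟩ (Function.update v n x) (Function.update v' n x') s s'
      (fun i hi => ?_) (fun i hi => ?_) hx⟩
    · by_cases hin : i = n
      · subst hin
        exact ⟨{q | q.2 = true}, fun y => by simp, fun y => by simp [huniq]⟩
      · obtain ⟨Q, hQ, hQ'⟩ := hFO i (Finset.mem_erase.mpr ⟨hin, hi⟩)
        exact ⟨{q | q.1 ∈ Q}, fun y => by simp [hin, hQ], fun y => by simp [hin, hQ']⟩
    · obtain ⟨Q, hQ, hQ'⟩ := hSO i hi
      exact ⟨{q | q.1 ∈ Q}, hQ, hQ'⟩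
  | exSO n φ ih =>
    classical
    rintro m hm C _ t t' h ht ht' c c' hty ⟨ℓ, hℓ, hℓ'⟩ v v' s s' hFO hSO ⟨(A : Set t.V), hA⟩
    obtain ⟨m, rfl⟩ : ∃ k, m = k + 1 := ⟨m - 1, by have : φ.qr + 1 ≤ m := hm; omega⟩
    obtain ⟨e', he'⟩ := hext m C t t' h c c' hty (fun y => decide (y ∈ A))
    refine ⟨{y | e' y = true}, ih m (Nat.le_of_succ_le_succ hm) (C × Bool) t t' h ht ht' _ _ he'
      ⟨fun q => ℓ q.1, hℓ, hℓ'⟩ v v' (Function.update s n A)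
      (Function.update s' n {y | e' y = true}) (fun i hi => ?_) (fun i hi => ?_) hA⟩
    · obtain ⟨Q, hQ, hQ'⟩ := hFO i hi
      exact ⟨{q | q.1 ∈ Q}, hQ, hQ'⟩
    · by_cases hin : i = n
      · subst hin
        exact ⟨{q | q.2 = true}, fun y => by simp, fun y => by simp⟩
      · obtain ⟨Q, hQ, hQ'⟩ := hSO i (Finset.mem_erase.mpr ⟨hin, hi⟩)
        exact ⟨{q | q.1 ∈ Q}, fun y => by simp [hin, hQ], fun y => by simp [hin, hQ']⟩

theorem msoEquiv_of_ty_eq {m : ℕ} {C : Type} [Finite C] {t t' : PTree p} {h : ℕ}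
    (ht : t.heightLe h) (ht' : t'.heightLe h) {c : t.V → C} {c' : t'.V → C}
    (hty : t.forest.ty (threshold m (Nat.card C)) c h t.root =
      t'.forest.ty (threshold m (Nat.card C)) c' h t'.root)
    (ℓ : C → Fin p) (hℓ : ∀ x, ℓ (c x) = t.label x) (hℓ' : ∀ x, ℓ (c' x) = t'.label x) :
    MStr.MSOEquiv m t.toStr t'.toStr := by
  rintro φ ⟨hFO, hSO⟩ hm
  constructor
  · intro hS v' s'
    exact realize_of_ty_eq φ m hm C t t' h ht ht' c c' hty ⟨ℓ, hℓ, hℓ'⟩ (fun _ => t.root) v'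
      (fun _ => ∅) s' (by simp [hFO]) (by simp [hSO]) (hS _ _)
  · intro hS v s
    exact realize_of_ty_eq φ m hm C t' t h ht' ht c' c hty.symm ⟨ℓ, hℓ', hℓ⟩ (fun _ => t'.root) v
      (fun _ => ∅) s (by simp [hFO]) (by simp [hSO]) (hS _ _)

end PTree

theorem tower_mono (h : ℕ) : Monotone (tower h) := by
  induction h with
  | zero => exact fun _ _ hxy => hxy
  | succ h ih => exact fun _ _ hxy => Nat.pow_le_pow_right two_pos (ih hxy)

theorem le_tower (h x : ℕ) : x ≤ tower h x := by
  induction h with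
  | zero => exact le_rfl
  | succ h ih => exact ih.trans Nat.lt_two_pow_self.le

theorem mul_tower_le {k x : ℕ} (hk : 1 ≤ k) (hx : 1 ≤ x) (h : ℕ) :
    k * tower h x ≤ tower h (k * x) := by
  induction h with
  | zero => exact le_rfl
  | succ h ih =>
    obtain ⟨k, rfl⟩ := Nat.exists_eq_add_of_le' hk
    have hx' : 1 ≤ tower h x := hx.trans (le_tower h x)
    calc (k + 1) * 2 ^ tower h x ≤ 2 ^ k * 2 ^ tower h x :=
          Nat.mul_le_mul_right _ Nat.lt_two_pow_self
      _ = 2 ^ (k + tower h x) := (pow_add _ _ _).symm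
      _ ≤ 2 ^ tower h ((k + 1) * x) := Nat.pow_le_pow_right two_pos (le_trans (by nlinarith) ih)

theorem threshold_le {B E h : ℕ}
    (hE : ∀ j n, j ≤ B → n * 2 ^ j ≤ 2 ^ B → typeCount n (threshold j n) h ≤ 2 ^ E) :
    ∀ j n, j ≤ B → n * 2 ^ j ≤ 2 ^ B → threshold j n h ≤ 2 ^ (E * j + 1) := by
  intro j
  induction j with
  | zero => exact fun n _ _ => by simp [threshold]
  | succ j ih =>
    intro n hj hn
    have hn' : n * 2 * 2 ^ j ≤ 2 ^ B := by rwa [mul_assoc, ← pow_succ']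
    calc threshold j (n * 2) h * typeCount (n * 2) (threshold j (n * 2)) h
        ≤ 2 ^ (E * j + 1) * 2 ^ E :=
          Nat.mul_le_mul (ih _ (by omega) hn') (hE _ _ (by omega) hn')
      _ = 2 ^ (E * (j + 1) + 1) := by ring

theorem typeCount_threshold_le {B : ℕ} (hB : 1 ≤ B) (h : ℕ) :
    ∀ j n, j ≤ B → n * 2 ^ j ≤ 2 ^ B →
      typeCount n (threshold j n) h ≤ 2 ^ tower h (5 ^ h * B) := by
  have hle : ∀ j n, n * 2 ^ j ≤ 2 ^ B → n ≤ 2 ^ B := fun j n hn =>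
    (Nat.le_mul_of_pos_right n (Nat.two_pow_pos j)).trans hn
  induction h with
  | zero => exact fun j n _ hn => by simpa [typeCount, tower] using hle j n hn
  | succ h ih =>
    intro j n hj hn
    have hthr := threshold_le ih j n hj hn
    have hcount := ih j n hj hn
    have hBE : B ≤ tower h (5 ^ h * B) :=
      (Nat.le_mul_of_pos_left B (by positivity)).trans (le_tower _ _)
    have htower : 2 ^ (5 * tower h (5 ^ h * B)) ≤ tower (h + 1) (5 ^ (h + 1) * B) := by
      refine Nat.pow_le_pow_right two_pos ((mul_tower_le (by omega) ?_ h).trans_eq ?_)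
      · exact Nat.mul_pos (by positivity) hB
      · congr 1
        ring
    generalize tower h (5 ^ h * B) = E at *
    have hE : E < 2 ^ E := Nat.lt_two_pow_self
    have hexp : E + (E * E + 2) * 2 ^ E ≤ 2 ^ (5 * E) := by
      have h₁ : E * E ≤ 2 ^ E * 2 ^ E := Nat.mul_le_mul hE.le hE.le
      have h₂ : 4 ≤ 2 ^ E * 2 ^ E := by
        have : 2 ≤ 2 ^ E := by omega
        nlinarith
      calc E + (E * E + 2) * 2 ^ E ≤ E * E * 2 ^ E + (E * E + 2 * (E * E)) * 2 ^ E := by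
            gcongr
            · nlinarith
            · nlinarith
        _ = 4 * (E * E) * 2 ^ E := by ring
        _ ≤ (2 ^ E * 2 ^ E) * (2 ^ E * 2 ^ E) * 2 ^ E := by gcongr
        _ = 2 ^ (5 * E) := by ring
    have hthr' : threshold j n h + 1 ≤ 2 ^ (E * E + 2) := by
      have h₁ : 2 ^ (E * j + 1) ≤ 2 ^ (E * E + 1) :=
        Nat.pow_le_pow_right two_pos (by nlinarith [Nat.mul_le_mul_left E (hj.trans hBE)])
      have h₂ : 1 ≤ 2 ^ (E * E + 1) := Nat.one_le_two_pow
      have h₃ : 2 ^ (E * E + 2) = 2 * 2 ^ (E * E + 1) := by ring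
      omega
    calc n * (threshold j n h + 1) ^ typeCount n (threshold j n) h
        ≤ 2 ^ E * (2 ^ (E * E + 2)) ^ 2 ^ E := by
          gcongr
          · exact (hle j n hn).trans (Nat.pow_le_pow_right two_pos hBE)
          · exact Nat.one_le_two_pow
      _ = 2 ^ (E + (E * E + 2) * 2 ^ E) := by rw [← pow_mul, ← pow_add]
      _ ≤ 2 ^ tower (h + 1) (5 ^ (h + 1) * B) :=
          Nat.pow_le_pow_right two_pos (hexp.trans htower)

theorem exists_prunedSize_le_tower (n h : ℕ) :
    ∃ k, ∀ m, 1 ≤ m → prunedSize n (threshold m n) h ≤ tower h (k * (m * (m + 1))) := by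
  induction h with
  | zero => exact ⟨1, fun m hm => by simp only [prunedSize, tower]; nlinarith⟩
  | succ h ih =>
    obtain ⟨k, hk⟩ := ih
    refine ⟨4 * (5 ^ h * (n + 1) + k), fun m hm => ?_⟩
    have hk := hk m hm
    have hmB : m ≤ (n + 1) * m := Nat.le_mul_of_pos_left m (Nat.succ_pos n)
    have hB : 1 ≤ (n + 1) * m := hm.trans hmB
    have hn : n * 2 ^ m ≤ 2 ^ ((n + 1) * m) := by
      calc n * 2 ^ m ≤ 2 ^ (n * m) * 2 ^ m := by
            gcongr
            exact Nat.lt_two_pow_self.le.trans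
              (Nat.pow_le_pow_right two_pos (Nat.le_mul_of_pos_right n hm))
        _ = 2 ^ ((n + 1) * m) := by ring
    have hcount := typeCount_threshold_le hB h m n hmB hn
    have hthr := threshold_le (typeCount_threshold_le hB h) m n hmB hn
    have hB' : 1 ≤ 5 ^ h * ((n + 1) * m) := Nat.mul_pos (by positivity) hB
    have hmul := mul_tower_le (Nat.succ_pos m) hB' h
    have hx : 1 ≤ (5 ^ h * (n + 1) + k) * (m * (m + 1)) :=
      Nat.mul_pos (by positivity) (by positivity)
    have hsum := mul_tower_le (k := 4) (by omega) hx h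
    have h₁ : tower h (m.succ * (5 ^ h * ((n + 1) * m))) ≤
        tower h ((5 ^ h * (n + 1) + k) * (m * (m + 1))) := by
      refine tower_mono h ?_
      calc (m + 1) * (5 ^ h * ((n + 1) * m)) = 5 ^ h * (n + 1) * (m * (m + 1)) := by ring
        _ ≤ (5 ^ h * (n + 1) + k) * (m * (m + 1)) :=
          Nat.mul_le_mul_right _ (Nat.le_add_right _ _)
    have h₂ : tower h (k * (m * (m + 1))) ≤
        tower h ((5 ^ h * (n + 1) + k) * (m * (m + 1))) :=
      tower_mono h (Nat.mul_le_mul_right _ (Nat.le_add_left _ _))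
    have h₃ := hx.trans (le_tower h _)
    rw [← mul_assoc 4] at hsum
    change _ ≤ 2 ^ tower h _
    refine le_trans ?_ (Nat.pow_le_pow_right two_pos hsum)
    generalize tower h ((5 ^ h * (n + 1) + k) * (m * (m + 1))) = X at *
    generalize tower h (5 ^ h * ((n + 1) * m)) = E at *
    have hP : prunedSize n (threshold m n) h ≤ 2 ^ X :=
      (hk.trans h₂).trans Nat.lt_two_pow_self.le
    calc typeCount n (threshold m n) h * (threshold m n h * prunedSize n (threshold m n) h) + 1
        ≤ 2 ^ E * (2 ^ (E * m + 1) * 2 ^ X) + 1 := by gcongr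
      _ = 2 ^ ((m + 1) * E + 1 + X) + 1 := by ring
      _ ≤ 2 ^ ((m + 1) * E + 1 + X) + 2 ^ ((m + 1) * E + 1 + X) := by
          gcongr
          exact Nat.one_le_two_pow
      _ = 2 ^ ((m + 1) * E + 1 + X + 1) := by ring
      _ ≤ 2 ^ (4 * X) := Nat.pow_le_pow_right two_pos (by
          have := hmul.trans h₁
          rw [Nat.succ_eq_add_one] at this
          omega)

namespace PTree

variable {p : ℕ}

/-- A set of nodes closed under parents contains the shortest walks from the root. -/
theorem exists_walk_induce (t : PTree p) {S : Set t.V}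
    (hS : t.forest.IsLeafHereditary S t.root) (x : S) :
    ∃ q : (t.g.induce S).Walk ⟨t.root, hS.root_mem⟩ x, q.length = t.g.dist t.root x := by
  induction hn : t.g.dist t.root (x : t.V) generalizing x with
  | zero =>
    obtain rfl : x = ⟨t.root, hS.root_mem⟩ :=
      Subtype.ext (t.tree.connected.dist_eq_zero_iff.mp hn).symm
    exact ⟨SimpleGraph.Walk.nil, rfl⟩
  | succ n ih =>
    have hne : (x : t.V) ≠ t.root := by
      intro h
      rw [h] at hn
      simp at hn
    obtain ⟨y, hy, hyx⟩ := hS.exists_parent x x.2 hne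
    have hd : t.g.dist t.root (x : t.V) = t.g.dist t.root y + 1 := hyx.2
    obtain ⟨q, hq⟩ := ih ⟨y, hy⟩ (by simp only; omega)
    have hadj : (t.g.induce S).Adj ⟨y, hy⟩ x := hyx.1
    exact ⟨q.concat hadj, by rw [SimpleGraph.Walk.length_concat, hq]⟩

/-- The subtree induced on a set of nodes closed under parents. -/
def induce (t : PTree p) {S : Set t.V} (hS : t.forest.IsLeafHereditary S t.root) : PTree p where
  V := S
  g := t.g.induce S
  tree := by
    refine ⟨?_, t.tree.isAcyclic.induce S⟩
    have : Nonempty S := ⟨⟨t.root, hS.root_mem⟩⟩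
    exact ⟨fun x y => (t.exists_walk_induce hS x).choose.reachable.symm.trans
      (t.exists_walk_induce hS y).choose.reachable⟩
  root := ⟨t.root, hS.root_mem⟩
  label x := t.label x

section

variable {t : PTree p} {S : Set t.V} (hS : t.forest.IsLeafHereditary S t.root)

theorem dist_induce (x : S) :
    (t.induce hS).g.dist (t.induce hS).root x = t.g.dist t.root x := by
  apply le_antisymm
  · obtain ⟨q, hq⟩ := t.exists_walk_induce hS x
    exact (SimpleGraph.dist_le q).trans_eq hq
  · obtain ⟨q, hq⟩ :=
      (t.induce hS).tree.connected.exists_walk_length_eq_dist (t.induce hS).root x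
    let f : (t.induce hS).g →g t.g := (SimpleGraph.Embedding.induce S).toHom
    exact (SimpleGraph.dist_le (q.map f)).trans_eq ((q.length_map f).trans hq)

theorem forest_induce_child (x y : S) :
    (t.induce hS).forest.child x y ↔ t.forest.child x y := by
  change _ ∧ _ ↔ _ ∧ _
  rw [dist_induce, dist_induce]
  rfl

theorem leafHereditary_induce : LeafHereditary (t.induce hS) t := by
  refine ⟨Subtype.val, Subtype.val_injective, fun _ _ => Iff.rfl, rfl, fun _ => rfl, ?_⟩
  rintro x hx h
  obtain ⟨w, hw, hxw⟩ := hS.exists_child x.1 x.2 h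
  exact hx ⟨⟨w, hw⟩, (forest_induce_child hS x ⟨w, hw⟩).mpr hxw⟩

theorem ty_induce {C : Type} (T : ℕ → ℕ) (c : t.V → C) (h : ℕ) (x : S) :
    (t.induce hS).forest.ty T (fun y : S => c y) h x = (t.forest.restrict S).ty T c h x :=
  RootedForest.ty_congr (F' := (t.induce hS).forest) (F := t.forest.restrict S)
    (c' := fun y : S => c y) Subtype.val Subtype.val_injective Set.univ
    (fun u _ w huw => ⟨trivial, (forest_induce_child hS u w).mp huw, w.2⟩)
    (fun u _ y huy => ⟨⟨y, huy.2⟩, (forest_induce_child hS u ⟨y, huy.2⟩).mpr huy.1, rfl⟩)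
    (fun _ _ => rfl) h x trivial

end

/-- Small equivalent leaf-hereditary subtrees, bounded by the number of counting types. -/
theorem exists_small_leafHereditary {d : ℕ} (m : ℕ) (t : PTree p) (ht : t.heightLe d) :
    ∃ t' : PTree p, LeafHereditary t' t ∧ (∀ h : ℕ, t.heightIs h → t'.heightIs h) ∧
      Cardinal.mk t'.V ≤
        ((prunedSize (p * (d + 1)) (threshold m (p * (d + 1))) d : ℕ) : Cardinal) ∧
      MStr.MSOEquiv m t'.toStr t.toStr := by
  have hC : Nat.card (Fin p × Fin (d + 1)) = p * (d + 1) := by simp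
  have hpos : 1 ≤ p * (d + 1) := Nat.mul_pos (Fin.pos (t.label t.root)) (Nat.succ_pos d)
  have hT : ∀ i, 1 ≤ threshold m (p * (d + 1)) i := fun i =>
    one_le_two.trans (two_le_threshold m hpos i)
  set c : t.V → Fin p × Fin (d + 1) :=
    fun x => (t.label x, ⟨t.g.dist t.root x, Nat.lt_succ_of_le (ht x)⟩) with hc
  obtain ⟨S, hS, hcard, hty⟩ := t.forest.exists_pruning hT c d t.root ht.forest
  have hty' := (ty_induce hS (threshold m (p * (d + 1))) c d ⟨t.root, hS.root_mem⟩).trans hty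
  have ht' : (t.induce hS).heightLe d := fun x => (dist_induce hS x).trans_le (ht x.1)
  refine ⟨t.induce hS, leafHereditary_induce hS, ?_, ?_, ?_⟩
  · rintro h ⟨hle, x, hx⟩
    refine ⟨fun y => (dist_induce hS y).trans_le (hle y.1), ?_⟩
    obtain ⟨x', -, hx'⟩ :=
      RootedForest.exists_color_of_ty_eq hT ht.forest hty'.symm (t.mem_desc_root x)
    have hd : t.g.dist t.root x'.1 = t.g.dist t.root x := congrArg (fun q => q.2.1) hx'
    exact ⟨x', (dist_induce hS x').trans (hd.trans hx)⟩
  · rw [hC] at hcard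
    change Cardinal.mk (S : Set t.V) ≤ _
    rw [Finset.coe_sort_coe, Cardinal.mk_coe_finset]
    exact_mod_cast hcard
  · refine msoEquiv_of_ty_eq ht' ht (c := fun y : S => c y.1) (c' := c) ?_ Prod.fst
      (fun _ => rfl) (fun _ => rfl)
    rw [hC]
    exact hty'

end PTree

/-- Small `MSO[m]`-equivalent leaf-hereditary subtrees of the same height, for
trees in `T_{d,p}`, with an elementary bound on the size. -/
theorem stmt2 (d p : ℕ) :
    ∃ g : ℕ → ℕ, StrictMono g ∧
      ∀ m : ℕ, 1 ≤ m → ∀ t : PTree p, t.heightLe d →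
        ∃ t' : PTree p, LeafHereditary t' t ∧
          (∀ h : ℕ, t.heightIs h → t'.heightIs h) ∧
          Cardinal.mk t'.V ≤
            ((tower d (g d * (m + 1) * (m + Nat.clog 2 p)) : ℕ) : Cardinal) ∧
          MStr.MSOEquiv m t'.toStr t.toStr := by
  obtain ⟨k, hk⟩ := exists_prunedSize_le_tower (p * (d + 1)) d
  refine ⟨fun x => k + x, fun _ _ h => Nat.add_lt_add_left h k, fun m hm t ht => ?_⟩
  obtain ⟨t', h₁, h₂, h₃, h₄⟩ := t.exists_small_leafHereditary m ht
  refine ⟨t', h₁, h₂, h₃.trans ?_, h₄⟩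
  refine Nat.cast_le.mpr ((hk m hm).trans (tower_mono d ?_))
  calc k * (m * (m + 1)) = k * (m + 1) * m := by ring
    _ ≤ (k + d) * (m + 1) * (m + Nat.clog 2 p) := by gcongr <;> omega
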